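/- arXiv:1911.03820 — 2 statements merged into one kernel-verified Lean document; each statement's English description precedes it below -/
import Mathlib

section
/- Let V be an even word and W a non-empty even word, and set w := [\overline{W}]. For n ≥ 1 write the matrix γ_V · γ_W^n as [[p_n, *],[q_n, *]]. Then q_n ≠ 0 for all n ≥ 1, and lim_{n→∞} p_n/q_n = γ_V • w, where γ_V • w := (a w + b)/(c w + d) for γ_V = [[a,b],[c,d]]. (In other words, the infinite continued fraction [V \overline{W}] whose partial quotients are V followed by periodic repetition of W has value γ_V • w.) -/
open Matrix Filter Topology

noncomputable section

/-- The matrix `[[k,1],[1,0]]` of a single partial quotient. -/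
def cfMat (k : ℕ+) : Matrix (Fin 2) (Fin 2) ℤ := !![(k : ℤ), 1; 1, 0]

/-- `γ_W` for a word `W = (k_1, …, k_r)` of positive integers. -/
def gammaWord (W : List ℕ+) : Matrix (Fin 2) (Fin 2) ℤ := (W.map cfMat).prod

/-- `W^n`, the `n`-fold concatenation of the word `W`. -/
def wordPow (W : List ℕ+) (n : ℕ) : List ℕ+ := (List.replicate n W).flatten

/-- `N(W)`: the largest `n` such that `W = V^n` for some word `V`. -/
def wordN (W : List ℕ+) : ℕ := sSup {n : ℕ | ∃ V : List ℕ+, W = wordPow V n}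

/-- Möbius action of an integer matrix on `ℝ`. -/
def actR (M : Matrix (Fin 2) (Fin 2) ℤ) (x : ℝ) : ℝ :=
  ((M 0 0 : ℝ) * x + (M 0 1 : ℝ)) / ((M 1 0 : ℝ) * x + (M 1 1 : ℝ))

/-- Möbius action of an integer matrix on `ℂ`. -/
def actC (M : Matrix (Fin 2) (Fin 2) ℤ) (z : ℂ) : ℂ :=
  ((M 0 0 : ℤ) * z + (M 0 1 : ℤ)) / ((M 1 0 : ℤ) * z + (M 1 1 : ℤ))

/-- Möbius action of a real matrix on `ℝ`. -/
def actRR (M : Matrix (Fin 2) (Fin 2) ℝ) (x : ℝ) : ℝ :=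
  (M 0 0 * x + M 0 1) / (M 1 0 * x + M 1 1)

/-- Möbius action of a real matrix on `ℂ`. -/
def actCR (M : Matrix (Fin 2) (Fin 2) ℝ) (z : ℂ) : ℂ :=
  ((M 0 0 : ℂ) * z + (M 0 1 : ℂ)) / ((M 1 0 : ℂ) * z + (M 1 1 : ℂ))

/-- Automorphy factor `j(M, x) = c·x + d`. -/
def jFac (M : Matrix (Fin 2) (Fin 2) ℝ) (x : ℝ) : ℝ := M 1 0 * x + M 1 1

/-- `w = [\overline{W}]`: `w` is the (unique) real number `> 1` fixed by the Möbius action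
of `γ_W`. -/
def IsCFValue (W : List ℕ+) (w : ℝ) : Prop := 1 < w ∧ actR (gammaWord W) w = w

/-- `w'` is the Galois conjugate of `[\overline{W}]`, i.e. the other real fixed point
of `γ_W`. -/
def IsCFConj (W : List ℕ+) (w w' : ℝ) : Prop := w' ≠ w ∧ actR (gammaWord W) w' = w'

/-- `g = γ_w` is the fundamental automorph of `w`: it fixes `w`, has `ε_w = j(g,w) > 1`, and
the stabilizer of `w` in `SL(2,ℤ)` is exactly `{± g^n : n ∈ ℤ}`. -/
def IsFundAutomorph (w : ℝ) (g : Matrix.SpecialLinearGroup (Fin 2) ℤ) : Prop :=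
  actR (g : Matrix (Fin 2) (Fin 2) ℤ) w = w ∧
  1 < (g 1 0 : ℝ) * w + (g 1 1 : ℝ) ∧
  ∀ M : Matrix.SpecialLinearGroup (Fin 2) ℤ,
    actR (M : Matrix (Fin 2) (Fin 2) ℤ) w = w ↔
      ∃ n : ℤ,
        (M : Matrix (Fin 2) (Fin 2) ℤ) =
          ((g ^ n : Matrix.SpecialLinearGroup (Fin 2) ℤ) : Matrix (Fin 2) (Fin 2) ℤ) ∨
        (M : Matrix (Fin 2) (Fin 2) ℤ) =
          -((g ^ n : Matrix.SpecialLinearGroup (Fin 2) ℤ) : Matrix (Fin 2) (Fin 2) ℤ)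

/-- Contour integral of `g` along the straight line segment from `a` to `b`. -/
def segInt (g : ℂ → ℂ) (a b : ℂ) : ℂ := (b - a) * ∫ t in (0:ℝ)..1, g (a + t * (b - a))

/-- The integrand of the differential `η_{w', w}`. -/
def eta (w w' : ℝ) (z : ℂ) : ℂ := 1 / (z - (w' : ℂ)) - 1 / (z - (w : ℂ))

/-- `∫_{z₀}^{z₁} f η_w`: the contour integral of `f(z)·(1/(z-w') - 1/(z-w)) dz`
along the straight line segment from `z₀` to `z₁`. -/
def cycInt (f : ℂ → ℂ) (w w' : ℝ) (z0 z1 : ℂ) : ℂ := segInt (fun z => f z * eta w w' z) z0 z1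

/-- A holomorphic modular function for `SL(2,ℤ)`: holomorphic on the upper half plane and
invariant under the Möbius action of `SL(2,ℤ)`. -/
def IsModular (f : ℂ → ℂ) : Prop :=
  DifferentiableOn ℂ f {z : ℂ | 0 < z.im} ∧
  ∀ g : Matrix.SpecialLinearGroup (Fin 2) ℤ, ∀ z : ℂ, 0 < z.im →
    f (actC (g : Matrix (Fin 2) (Fin 2) ℤ) z) = f z

/-- `w` is a real quadratic irrational with Galois conjugate `w'` (the other root of the
same integral quadratic equation). -/
def IsQuadPair (w w' : ℝ) : Prop :=
  Irrational w ∧ w' ≠ w ∧ ∃ a b c : ℤ, a ≠ 0 ∧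
    (a : ℝ) * w ^ 2 + (b : ℝ) * w + (c : ℝ) = 0 ∧
    (a : ℝ) * w' ^ 2 + (b : ℝ) * w' + (c : ℝ) = 0

/-- The `i`-th term (0-indexed) of the regular continued fraction expansion of `x`:
term `0` is `⌊x⌋` and term `i+1` is the `i`-th partial denominator. -/
def cfTerm (x : ℝ) (i : ℕ) : Option ℝ :=
  match i with
  | 0 => some (GenContFract.of x).h
  | i + 1 => (GenContFract.of x).partDens.get? i

/-- `w` is a real quadratic irrational. -/
def IsQuadIrr (w : ℝ) : Prop :=
  Irrational w ∧ ∃ a b c : ℤ, a ≠ 0 ∧ (a : ℝ) * w ^ 2 + (b : ℝ) * w + (c : ℝ) = 0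

abbrev SL2Z := Matrix.SpecialLinearGroup (Fin 2) ℤ
abbrev SL2R := Matrix.SpecialLinearGroup (Fin 2) ℝ

theorem gammaWord_cons (k : ℕ+) (L : List ℕ+) :
    gammaWord (k :: L) = cfMat k * gammaWord L := by
  simp [gammaWord]

theorem gammaWord_append (K L : List ℕ+) :
    gammaWord (K ++ L) = gammaWord K * gammaWord L := by
  simp [gammaWord]

theorem gammaWord_wordPow (W : List ℕ+) (n : ℕ) :
    gammaWord (wordPow W n) = gammaWord W ^ n := by
  induction n with
  | zero => simp [wordPow, gammaWord]
  | succ n ih =>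
    rw [pow_succ', ← ih, ← gammaWord_append]
    simp [wordPow, List.replicate_succ]

theorem gammaWord_entries (L : List ℕ+) :
    1 ≤ gammaWord L 0 0 ∧ 0 ≤ gammaWord L 0 1 ∧ 0 ≤ gammaWord L 1 0 ∧ 0 ≤ gammaWord L 1 1 ∧
      1 ≤ gammaWord L 1 0 + gammaWord L 1 1 := by
  induction L with
  | nil => simp [gammaWord]
  | cons k L ih =>
    obtain ⟨ha, hb, hc, hd, hcd⟩ := ih
    have hk : (1 : ℤ) ≤ (k : ℤ) := by exact_mod_cast k.pos
    simp only [gammaWord_cons, cfMat, Matrix.mul_apply, Fin.sum_univ_two, Matrix.of_apply,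
      Matrix.cons_val_zero, Matrix.cons_val_one, Matrix.cons_val', one_mul, zero_mul, add_zero]
    refine ⟨?_, ?_, ?_, ?_, ?_⟩ <;> nlinarith

theorem one_le_gammaWord_one_zero {L : List ℕ+} (hL : L ≠ []) : 1 ≤ gammaWord L 1 0 := by
  cases L with
  | nil => exact absurd rfl hL
  | cons k L =>
    simpa [gammaWord_cons, cfMat, Matrix.mul_apply, Fin.sum_univ_two] using
      (gammaWord_entries L).1

theorem det_gammaWord (L : List ℕ+) : (gammaWord L).det = (-1) ^ L.length := by
  induction L with
  | nil => simp [gammaWord]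
  | cons k L ih =>
    rw [gammaWord_cons, Matrix.det_mul, ih]
    simp [cfMat, Matrix.det_fin_two, pow_succ]

theorem gammaWord_mul_sub_mul_of_even {L : List ℕ+} (hL : Even L.length) :
    (gammaWord L 0 0 : ℝ) * gammaWord L 1 1 - gammaWord L 0 1 * gammaWord L 1 0 = 1 := by
  have h := det_gammaWord L
  rw [hL.neg_one_pow, Matrix.det_fin_two] at h
  exact_mod_cast h

/-- If `w` is fixed by `M`, then `(1, -w)` is a left eigenvector of `M`. -/
theorem pow_zero_zero_sub_mul_pow_one_zero {M : Matrix (Fin 2) (Fin 2) ℤ} {w : ℝ}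
    (h : (M 0 0 : ℝ) * w + M 0 1 = w * (M 1 0 * w + M 1 1)) (n : ℕ) :
    (((M ^ n) 0 0 : ℤ) : ℝ) - w * ((M ^ n) 1 0 : ℤ) = ((M 0 0 : ℝ) - w * M 1 0) ^ n := by
  induction n with
  | zero => simp
  | succ n ih =>
    rw [pow_succ', pow_succ', ← ih]
    simp only [Matrix.mul_apply, Fin.sum_univ_two]
    push_cast
    linear_combination (((M ^ n) 1 0 : ℤ) : ℝ) * h

theorem denom_gammaWord_ge_one (L : List ℕ+) {w : ℝ} (hw : 1 < w) :
    1 ≤ (gammaWord L 1 0 : ℝ) * w + gammaWord L 1 1 := by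
  obtain ⟨-, -, hc, -, hcd⟩ := gammaWord_entries L
  have hhc : (0 : ℝ) ≤ gammaWord L 1 0 := by exact_mod_cast hc
  have hhcd : (1 : ℝ) ≤ gammaWord L 1 0 + gammaWord L 1 1 := by exact_mod_cast hcd
  nlinarith

/-- The convergents of the eventually periodic continued fraction `[V \overline{W}]`
converge to `γ_V • [\overline{W}]`, and the denominators `q_n` are nonzero for `n ≥ 1`. -/
theorem convergents_of_eventually_periodic
    (V W : List ℕ+) (hV : Even V.length) (hWne : W ≠ []) (hWe : Even W.length)
    (w : ℝ) (hw : IsCFValue W w) :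
    (∀ n : ℕ, 1 ≤ n → (gammaWord V * gammaWord W ^ n) 1 0 ≠ 0) ∧
    Tendsto (fun n : ℕ =>
        (((gammaWord V * gammaWord W ^ n) 0 0 : ℤ) : ℝ) /
          (((gammaWord V * gammaWord W ^ n) 1 0 : ℤ) : ℝ))
      atTop (𝓝 (actR (gammaWord V) w)) := by
  obtain ⟨hw1, hfix⟩ := hw
  have hq : ∀ n : ℕ, 1 ≤ n → 1 ≤ (gammaWord V * gammaWord W ^ n) 1 0 := by
    intro n hn
    rw [← gammaWord_wordPow, ← gammaWord_append]
    refine one_le_gammaWord_one_zero ?_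
    obtain ⟨m, rfl⟩ := Nat.exists_eq_add_of_le' hn
    simp [wordPow, List.replicate_succ, hWne]
  refine ⟨fun n hn => by have := hq n hn; omega, ?_⟩
  have hden := denom_gammaWord_ge_one W hw1
  have hdenV := denom_gammaWord_ge_one V hw1
  have hdet := gammaWord_mul_sub_mul_of_even hWe
  have hdetV := gammaWord_mul_sub_mul_of_even hV
  have heq : (gammaWord W 0 0 : ℝ) * w + gammaWord W 0 1
      = w * (gammaWord W 1 0 * w + gammaWord W 1 1) := by
    rw [actR, div_eq_iff (by linarith)] at hfix
    exact hfix
  have hlam : 1 < (gammaWord W 1 0 : ℝ) * w + gammaWord W 1 1 := by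
    have hc : (1 : ℝ) ≤ gammaWord W 1 0 := by
      exact_mod_cast one_le_gammaWord_one_zero hWne
    have hd : (0 : ℝ) ≤ gammaWord W 1 1 := by
      exact_mod_cast (gammaWord_entries W).2.2.2.1
    nlinarith
  set μ : ℝ := (gammaWord W 0 0 : ℝ) - w * gammaWord W 1 0 with hμ
  have hmul : μ * ((gammaWord W 1 0 : ℝ) * w + gammaWord W 1 1) = 1 := by
    rw [hμ]
    linear_combination hdet + (gammaWord W 1 0 : ℝ) * heq
  have hμ0 : 0 < μ := pos_of_mul_pos_left (by rw [hmul]; exact one_pos) (by linarith)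
  have hμ1 : μ < 1 := by nlinarith
  have hlim := tendsto_pow_atTop_nhds_zero_of_lt_one hμ0.le hμ1
  rw [tendsto_iff_dist_tendsto_zero]
  refine squeeze_zero' (Eventually.of_forall fun _ => dist_nonneg) ?_ hlim
  filter_upwards [eventually_ge_atTop 1] with n hn
  have hqn : (1 : ℝ) ≤ ((gammaWord V * gammaWord W ^ n) 1 0 : ℤ) := by
    exact_mod_cast hq n hn
  have hpow := pow_zero_zero_sub_mul_pow_one_zero heq n
  have hkey : (((gammaWord V * gammaWord W ^ n) 0 0 : ℤ) : ℝ) *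
        ((gammaWord V 1 0 : ℝ) * w + gammaWord V 1 1) -
      (((gammaWord V * gammaWord W ^ n) 1 0 : ℤ) : ℝ) *
        ((gammaWord V 0 0 : ℝ) * w + gammaWord V 0 1) = μ ^ n := by
    rw [← hpow]
    simp only [Matrix.mul_apply, Fin.sum_univ_two]
    push_cast
    linear_combination ((((gammaWord W ^ n) 0 0 : ℤ) : ℝ) -
      w * ((gammaWord W ^ n) 1 0 : ℤ)) * hdetV
  rw [Real.dist_eq, actR, div_sub_div _ _ (by linarith) (by linarith), hkey,
    abs_of_nonneg (by positivity)]
  exact div_le_self (by positivity) (one_le_mul_of_one_le_of_one_le hqn hdenV)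
end
end

section
/- Let w be a real quadratic irrational with Galois conjugate w' (the other root of its minimal polynomial over ℚ), and let M = [[p,q],[r,s]] be a 2×2 integer matrix with det M = ±1 and M • w = w. Then M • w' = w' and (r·w + s)·(r·w' + s) = det M; that is, the field norm N_{ℚ(w)/ℚ}(r·w + s) equals det M. -/
open Matrix Filter Topology

noncomputable section

/-- An irrational real number satisfies no nontrivial linear equation over `ℤ`. -/
theorem int_coeffs_eq_zero_of_irrational {w : ℝ} (hw : Irrational w) {m n : ℤ}
    (h : (m : ℝ) * w + n = 0) : m = 0 ∧ n = 0 := by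
  have hm : m = 0 := by
    by_contra hm
    exact ((hw.intCast_mul hm).add_intCast n).ne_zero h
  subst hm
  exact ⟨rfl, by simpa using h⟩

/-- An integral quadratic form in `w` that vanishes also vanishes at the Galois conjugate. -/
theorem IsQuadPair.conj_root {w w' : ℝ} (hq : IsQuadPair w w') {r t u : ℤ}
    (h : (r : ℝ) * w ^ 2 + t * w + u = 0) : (r : ℝ) * w' ^ 2 + t * w' + u = 0 := by
  obtain ⟨hw, -, a, b, c, ha, h₁, h₂⟩ := hq
  have hlin : ((a * t - r * b : ℤ) : ℝ) * w + ((a * u - r * c : ℤ) : ℝ) = 0 := by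
    push_cast
    linear_combination a * h - r * h₁
  obtain ⟨ht, hu⟩ := int_coeffs_eq_zero_of_irrational hw hlin
  have ht' : (a : ℝ) * t - r * b = 0 := by exact_mod_cast ht
  have hu' : (a : ℝ) * u - r * c = 0 := by exact_mod_cast hu
  have ha' : (a : ℝ) ≠ 0 := by exact_mod_cast ha
  refine (mul_eq_zero.mp ?_).resolve_left ha'
  linear_combination r * h₂ + w' * ht' + hu'

/-- If `M ∈ GL(2,ℤ)` fixes a real quadratic irrational `w`, then it also fixes its Galois
conjugate `w'` and `(r·w + s)(r·w' + s) = det M`, i.e. `N_{ℚ(w)/ℚ}(r·w + s) = det M`. -/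
theorem fixes_conjugate_and_norm_eq_det
    (w w' : ℝ) (hq : IsQuadPair w w')
    (M : Matrix (Fin 2) (Fin 2) ℤ) (hdet : M.det = 1 ∨ M.det = -1)
    (hMw : actR M w = w) :
    actR M w' = w' ∧
    ((M 1 0 : ℝ) * w + (M 1 1 : ℝ)) * ((M 1 0 : ℝ) * w' + (M 1 1 : ℝ)) = (M.det : ℝ) := by
  have hw : Irrational w := hq.1
  have hne : w' - w ≠ 0 := sub_ne_zero.mpr hq.2.1
  have hd : (M.det : ℝ) = M 0 0 * M 1 1 - M 0 1 * M 1 0 := by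
    rw [Matrix.det_fin_two]
    push_cast
    ring
  have hd0 : (M.det : ℝ) ≠ 0 := by
    rcases hdet with h | h <;> rw [h] <;> norm_num
  unfold actR at hMw ⊢
  have hden : (M 1 0 : ℝ) * w + M 1 1 ≠ 0 := by
    intro h
    rw [h, div_zero] at hMw
    exact hw.ne_zero hMw.symm
  rw [div_eq_iff hden] at hMw
  have hroot : (M 1 0 : ℝ) * w ^ 2 + ((M 1 1 - M 0 0 : ℤ) : ℝ) * w + ((-M 0 1 : ℤ) : ℝ) = 0 := by
    push_cast
    linear_combination -hMw
  have hroot' := hq.conj_root hroot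
  push_cast at hroot hroot'
  have hsum : (M 1 0 : ℝ) * (w' + w) + (M 1 1 - M 0 0) = 0 := by
    refine (mul_eq_zero.mp ?_).resolve_left hne
    linear_combination hroot' - hroot
  have hnorm : ((M 1 0 : ℝ) * w + M 1 1) * ((M 1 0 : ℝ) * w' + M 1 1) = M.det := by
    rw [hd]
    linear_combination (M 1 0 * w + M 1 1) * hsum - M 1 0 * hroot
  have hden' : (M 1 0 : ℝ) * w' + M 1 1 ≠ 0 := by
    intro h
    rw [h, mul_zero] at hnorm
    exact hd0 hnorm.symm
  refine ⟨?_, hnorm⟩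
  rw [div_eq_iff hden']
  linear_combination -hroot'
end
end
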